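/- Let G be a finitely generated group, E an admissible family of subgroups of G, T a non-trivial minimal E-tree with finitely many G-orbits of edges, and H ∈ E. Let v be a vertex of T and let S be a subtree of T containing v such that S ∖ {v} is a union of connected components of T ∖ {v}, and suppose that X = {g ∈ G : g·v ∉ S} is an H-almost invariant subset of G. Then the coboundary δS, consisting of the edges vw with w ∉ S, is a finite set of edges each of whose stabilizers is commensurable with H (so δS is contained in the cylinder associated to the commensurability class of H). -/

import Mathlib

open scoped Pointwise symmDiff

namespace SSRN

section Group
variable {G : Type*} [Group G]

/-- A subset of `G` is `H`-finite if it is contained in finitely many orbits of the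
action of `H` on `G` by left multiplication. -/
def HFin (H : Subgroup G) (X : Set G) : Prop :=
  ∃ F : Finset G, X ⊆ ⋃ f ∈ F, (· * f) '' (H : Set G)

/-- Two subsets of `G` are `H`-equivalent if their symmetric difference is `H`-finite. -/
def AIEquiv (H : Subgroup G) (X Y : Set G) : Prop := HFin H (X ∆ Y)

/-- `X` is an `H`-almost invariant subset of `G`. -/
def IsAI (H : Subgroup G) (X : Set G) : Prop :=
  (∀ h ∈ H, (h * ·) '' X = X) ∧ ∀ s : G, HFin H (((· * s) '' X) ∆ X)

/-- `X` is a non-trivial `H`-almost invariant subset of `G`. -/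
def NontrivAI (H : Subgroup G) (X : Set G) : Prop :=
  IsAI H X ∧ ¬ HFin H X ∧ ¬ HFin H Xᶜ

/-- The `H`-almost invariant set `X` crosses `Y`: none of the four corners is `H`-finite. -/
def Crosses (H : Subgroup G) (X Y : Set G) : Prop :=
  ¬ HFin H (X ∩ Y) ∧ ¬ HFin H (X ∩ Yᶜ) ∧ ¬ HFin H (Xᶜ ∩ Y) ∧ ¬ HFin H (Xᶜ ∩ Yᶜ)

/-- Crossing of (non-trivial) almost invariant sets, quantifying over the groups over
which they are almost invariant. -/
def CrossesAny (X X' : Set G) : Prop :=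
  ∃ H K : Subgroup G, NontrivAI H X ∧ NontrivAI K X' ∧ Crosses H X X'

/-- `X` and `X'` determine the same unordered pair `{[X], [X*]}` of equivalence classes. -/
def SamePair (X X' : Set G) : Prop :=
  ∃ H : Subgroup G, NontrivAI H X ∧ (HFin H (X ∆ X') ∨ HFin H (X ∆ X'ᶜ))

/-- An admissible family of subgroups: conjugacy invariant, closed under commensurability,
and no member contains another with infinite index. -/
def Admissible (E : Set (Subgroup G)) : Prop :=
  (∀ H ∈ E, ∀ g : G, (MulAut.conj g • H) ∈ E) ∧
  (∀ H ∈ E, ∀ K : Subgroup G, Subgroup.Commensurable K H → K ∈ E) ∧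
  (∀ A ∈ E, ∀ B ∈ E, A ≤ B → A.relIndex B ≠ 0)

end Group

section Tree

variable {V : Type*}

/-- The stabilizer of an edge `e : Sym2 V` under the action of `G`. -/
def edgeStab (G : Type*) [Group G] [MulAction G V] (e : Sym2 V) : Subgroup G where
  carrier := {g | Sym2.map (g • ·) e = e}
  one_mem' := by
    show Sym2.map ((1 : G) • ·) e = e
    have : ((1 : G) • · : V → V) = id := by funext v; simp
    rw [this, Sym2.map_id]; rfl
  mul_mem' := by
    intro a b ha hb
    show Sym2.map ((a * b) • ·) e = e
    have : ((a * b) • · : V → V) = (a • ·) ∘ (b • ·) := by funext v; simp [mul_smul]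
    rw [this, ← Sym2.map_map, hb, ha]
  inv_mem' := by
    intro a ha
    show Sym2.map (a⁻¹ • ·) e = e
    conv_lhs => rw [← ha]
    rw [Sym2.map_map]
    have : ((a⁻¹ • ·) ∘ (a • ·) : V → V) = id := by funext v; simp
    rw [this, Sym2.map_id]; rfl

variable (T : SimpleGraph V)

/-- `G` acts on the graph `T` by graph automorphisms. -/
def ActsOn (G : Type*) [Group G] [MulAction G V] : Prop :=
  ∀ (g : G) (u v : V), T.Adj u v → T.Adj (g • u) (g • v)

/-- The action of `G` on `T` is without inversions. -/
def NoInversions (G : Type*) [Group G] [MulAction G V] : Prop :=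
  ∀ (g : G) (u v : V), T.Adj u v → ¬ (g • u = v ∧ g • v = u)

/-- `w` lies between `u` and `v`: it is on every path from `u` to `v`. -/
def Btw (u w v : V) : Prop := ∀ p : T.Walk u v, p.IsPath → w ∈ p.support

/-- The action of `G` on the tree `T` is minimal: every nonempty invariant subtree
(convex invariant set of vertices) is the whole vertex set. -/
def MinimalAction (G : Type*) [Group G] [MulAction G V] : Prop :=
  ∀ A : Set V, A.Nonempty → (∀ (g : G), ∀ a ∈ A, g • a ∈ A) →
    (∀ u ∈ A, ∀ v ∈ A, ∀ w : V, Btw T u w v → w ∈ A) → A = Set.univ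

/-- The action of `G` is non-trivial: there is no global fixed vertex. -/
def NontrivialAction (G : Type*) [Group G] [MulAction G V] : Prop :=
  ¬ ∃ v : V, ∀ g : G, g • v = v

/-- `T` is an `E`-tree: all edge stabilizers belong to `E`. -/
def IsETree (G : Type*) [Group G] [MulAction G V] (E : Set (Subgroup G)) : Prop :=
  ∀ e ∈ T.edgeSet, edgeStab G e ∈ E

/-- There are finitely many `G`-orbits of edges. -/
def FinEdgeOrbits (G : Type*) [Group G] [MulAction G V] : Prop :=
  ∃ F : Finset (Sym2 V), ∀ e ∈ T.edgeSet, ∃ e₀ ∈ F, ∃ g : G, Sym2.map (g • ·) e₀ = e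

/-- A cylinder of `T`: an equivalence class of edges for commensurability of stabilizers. -/
def IsCylinder (G : Type*) [Group G] [MulAction G V] (Y : Set (Sym2 V)) : Prop :=
  Y.Nonempty ∧ Y ⊆ T.edgeSet ∧
    ∀ e ∈ Y, ∀ e' ∈ T.edgeSet,
      (e' ∈ Y ↔ Subgroup.Commensurable (edgeStab G e) (edgeStab G (V := V) e'))

/-- The set of vertices of a set of edges (e.g. of a cylinder). -/
def cylVerts (Y : Set (Sym2 V)) : Set V := {v | ∃ e ∈ Y, v ∈ e}

/-- The boundary of a cylinder: its vertices lying in another cylinder,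
i.e. incident to an edge outside the cylinder. -/
def cylBoundary (Y : Set (Sym2 V)) : Set V :=
  {v | v ∈ cylVerts Y ∧ ∃ e ∈ T.edgeSet, v ∈ e ∧ e ∉ Y}

/-- `H` belongs to the commensurability class associated to the cylinder `Y`. -/
def InClassOf (G : Type*) [Group G] [MulAction G V] (Y : Set (Sym2 V)) (H : Subgroup G) : Prop :=
  ∃ e ∈ Y, Subgroup.Commensurable H (edgeStab G e)

/-- The coboundary of a set of vertices: edges with exactly one endpoint in it. -/
def cobdry (S : Set V) : Set (Sym2 V) :=
  {e | e ∈ T.edgeSet ∧ ∃ u v : V, e = s(u, v) ∧ u ∈ S ∧ v ∉ S}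

/-- `S` is a special forest based on the cylinder `Y`. -/
def IsSpecialForest (S : Set V) (Y : Set (Sym2 V)) : Prop :=
  (cobdry T S).Finite ∧ cobdry T S ⊆ Y

/-- A set of vertices is non-trivial if it is neither finite nor cofinite. -/
def NontrivForest (S : Set V) : Prop := ¬ S.Finite ∧ ¬ (Sᶜ : Set V).Finite

/-- The almost invariant set associated to a set of vertices. -/
def XS (G : Type*) [Group G] [MulAction G V] (v₀ : V) (S : Set V) : Set G :=
  {g : G | g • v₀ ∈ S}

/-- The component `T_e` of `T` minus the open edge `e = s(u,v)` containing the terminal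
vertex `v`. -/
def halfTree (u v : V) : Set V :=
  {w | ∃ p : T.Walk v w, p.IsPath ∧ s(u, v) ∉ p.edges}

/-- The almost invariant set `Z_e` dual to the oriented edge `(u, v)`. -/
def Ze (G : Type*) [Group G] [MulAction G V] (v₀ u v : V) : Set G :=
  XS G v₀ (halfTree T u v)

/-- `v` has finitely many incident edges in `Y`. -/
def FiniteValenceIn (Y : Set (Sym2 V)) (v : V) : Prop := {e | e ∈ Y ∧ v ∈ e}.Finite

/-- The peripheral special forest `S_{v,Y}`: the component of `v` in `T` minus the open
edges of `Y` incident to `v`. -/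
def periForest (Y : Set (Sym2 V)) (v : V) : Set V :=
  {w | ∃ p : T.Walk v w, p.IsPath ∧ ∀ e ∈ Y, v ∈ e → e ∉ p.edges}

/-- The peripheral almost invariant set `X_{v,Y}`. -/
def XvY (G : Type*) [Group G] [MulAction G V] (v₀ : V) (Y : Set (Sym2 V)) (v : V) : Set G :=
  XS G v₀ (periForest T Y v)

/-- A peripheral special forest: one equivalent to some `S_{v,Y}`. -/
def PeripheralForest (G : Type*) [Group G] [MulAction G V] (S : Set V) : Prop :=
  ∃ (Y : Set (Sym2 V)) (v : V), IsCylinder T G Y ∧ v ∈ cylBoundary T Y ∧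
    FiniteValenceIn Y v ∧ (S ∆ periForest T Y v).Finite

/-- The Boolean algebra `B_C(T)` of (representatives of) almost invariant sets based on the
cylinder `Y`: the smallest family containing the sets `Z_e`, `e ∈ Y`, closed under
complement, intersection and `H`-equivalence. -/
def BCT {G : Type*} [Group G] [MulAction G V] (v₀ : V) (Y : Set (Sym2 V)) (H : Subgroup G) :
    Set (Set G) :=
  ⋂₀ {F : Set (Set G) |
    (∀ u v : V, T.Adj u v → s(u, v) ∈ Y → Ze T G v₀ u v ∈ F) ∧
    (∀ X ∈ F, Xᶜ ∈ F) ∧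
    (∀ X ∈ F, ∀ X' ∈ F, X ∩ X' ∈ F) ∧
    (∀ X ∈ F, ∀ X' : Set G, HFin H (X ∆ X') → X' ∈ F)}

/-- The set `B(T)` of (representatives of) almost invariant sets based on `T`. -/
def BT (G : Type*) [Group G] [MulAction G V] (v₀ : V) : Set (Set G) :=
  {X | ∃ Y : Set (Sym2 V), IsCylinder T G Y ∧ ∃ e ∈ Y, X ∈ BCT T v₀ Y (edgeStab G e)}

/-- Elements of `B(T)` that are non-trivial almost invariant sets. -/
def NontrivB (G : Type*) [Group G] [MulAction G V] (v₀ : V) : Set (Set G) :=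
  {X | X ∈ BT T G v₀ ∧ ∃ H : Subgroup G, NontrivAI H X}

/-- One step of the relation generating cross-connected components. -/
def ccStep (G : Type*) [Group G] [MulAction G V] (v₀ : V) (X X' : Set G) : Prop :=
  X ∈ NontrivB T G v₀ ∧ X' ∈ NontrivB T G v₀ ∧ (CrossesAny X X' ∨ SamePair X X')

/-- The equivalence relation generated by crossing (and identification of equivalent sets
and complements) on `B(T)`. -/
def ccRel (G : Type*) [Group G] [MulAction G V] (v₀ : V) : Set G → Set G → Prop :=
  Relation.EqvGen (ccStep T G v₀)

/-- The cross-connected component of (the pair determined by) `X`. -/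
def ccOf (G : Type*) [Group G] [MulAction G V] (v₀ : V) (X : Set G) : Set (Set G) :=
  {X' | ccRel T G v₀ X X'}

/-- `C` is a cross-connected component of `B(T)`. -/
def IsCCC (G : Type*) [Group G] [MulAction G V] (v₀ : V) (C : Set (Set G)) : Prop :=
  ∃ X ∈ NontrivB T G v₀, C = ccOf T G v₀ X

/-- A cross-connected component is based on the cylinder `Y` if its members are almost
invariant over subgroups in the commensurability class of `Y`. -/
def CCCBasedOn (G : Type*) [Group G] [MulAction G V] (Y : Set (Sym2 V)) (C : Set (Set G)) :
    Prop :=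
  ∃ X ∈ C, ∃ H : Subgroup G, InClassOf G Y H ∧ NontrivAI H X

/-- A peripheral cross-connected component. -/
def PeripheralCCC (G : Type*) [Group G] [MulAction G V] (v₀ : V) (C : Set (Set G)) : Prop :=
  ∃ (Y : Set (Sym2 V)) (v : V), IsCylinder T G Y ∧ v ∈ cylBoundary T Y ∧
    FiniteValenceIn Y v ∧ XvY T G v₀ Y v ∈ C

/-- Betweenness of (distinct) cross-connected components. -/
def CCCBetween {G : Type*} [Group G] (C₁ C₂ C₃ : Set (Set G)) : Prop :=
  C₁ ≠ C₂ ∧ C₂ ≠ C₃ ∧ C₁ ≠ C₃ ∧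
    ∃ X₁ ∈ C₁, ∃ X₂ ∈ C₂, ∃ X₃ ∈ C₃, X₁ ⊆ X₂ ∧ X₂ ⊆ X₃

/-- A star of cross-connected components. -/
def IsStar (G : Type*) [Group G] [MulAction G V] (v₀ : V) (St : Set (Set (Set G))) : Prop :=
  (∀ C ∈ St, IsCCC T G v₀ C) ∧ St.Nontrivial ∧
  (∀ C ∈ St, ∀ C' ∈ St, ∀ C'' : Set (Set G), IsCCC T G v₀ C'' → ¬ CCCBetween C C'' C') ∧
  (∀ St' : Set (Set (Set G)), St ⊆ St' → (∀ C ∈ St', IsCCC T G v₀ C) →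
    (∀ C ∈ St', ∀ C' ∈ St', ∀ C'' : Set (Set G), IsCCC T G v₀ C'' → ¬ CCCBetween C C'' C') →
    St' = St)

/-- The regular neighbourhood `RN(B(T))`: the bipartite graph on cross-connected
components and stars. -/
def RNGraph (G : Type*) [Group G] [MulAction G V] (v₀ : V) :
    SimpleGraph ({C : Set (Set G) // IsCCC T G v₀ C} ⊕
      {St : Set (Set (Set G)) // IsStar T G v₀ St}) where
  Adj x y :=
    match x, y with
    | Sum.inl C, Sum.inr St => C.1 ∈ St.1
    | Sum.inr St, Sum.inl C => C.1 ∈ St.1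
    | _, _ => False
  symm := ⟨by rintro (C | St) (C' | St') h <;> exact h⟩
  loopless := ⟨by rintro (C | St) h <;> exact h⟩

/-- Vertices of `T` lying in at least two cylinders. -/
def TcV0 (G : Type*) [Group G] [MulAction G V] : Set V :=
  {v | ∃ Y Y' : Set (Sym2 V), IsCylinder T G Y ∧ IsCylinder T G Y' ∧ Y ≠ Y' ∧
    v ∈ cylVerts Y ∧ v ∈ cylVerts Y'}

/-- The tree of cylinders `T_c` of `T`, as a bipartite graph. -/
def TcGraph (G : Type*) [Group G] [MulAction G V] :
    SimpleGraph ({v : V // v ∈ TcV0 T G} ⊕ {Y : Set (Sym2 V) // IsCylinder T G Y}) where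
  Adj x y :=
    match x, y with
    | Sum.inl v, Sum.inr Y => v.1 ∈ cylVerts Y.1
    | Sum.inr Y, Sum.inl v => v.1 ∈ cylVerts Y.1
    | _, _ => False
  symm := ⟨by rintro (v | Y) (v' | Y') h <;> exact h⟩
  loopless := ⟨by rintro (v | Y) h <;> exact h⟩


/-- `T` dominates `T'`: there is a `G`-equivariant map. -/
def Dominates (G : Type*) [Group G] {V V' : Type*} [MulAction G V] [MulAction G V']
    (T : SimpleGraph V) (T' : SimpleGraph V') : Prop :=
  ∃ f : V → V', ∀ (g : G) (x : V), f (g • x) = g • f x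

end Tree

section Subdiv

variable {α β : Type*}

/-- `S` is a subdivision of `Γ` via the vertex embedding `f`. -/
def SubdivVia (f : α → β) (S : SimpleGraph β) (Γ : SimpleGraph α) : Prop :=
  Function.Injective f ∧
  (∀ b : β, b ∉ Set.range f → ∃ x y : β, x ≠ y ∧ S.neighborSet b = {x, y}) ∧
  (∀ u : α, Nonempty (Γ.neighborSet u ≃ S.neighborSet (f u))) ∧
  (∀ u v : α, Γ.Adj u v ↔ ∃ p : S.Walk (f u) (f v), p.IsPath ∧ 1 ≤ p.length ∧
      ∀ w ∈ p.support, w ∈ Set.range f → w = f u ∨ w = f v) ∧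
  (∀ e ∈ S.edgeSet, ∃ (u v : α) (p : S.Walk (f u) (f v)), Γ.Adj u v ∧ p.IsPath ∧
      (∀ w ∈ p.support, w ∈ Set.range f → w = f u ∨ w = f v) ∧ e ∈ p.edges)

/-- `S` is (isomorphic to) a subdivision of `Γ`. -/
def IsSubdivision (S : SimpleGraph β) (Γ : SimpleGraph α) : Prop :=
  ∃ f : α → β, SubdivVia f S Γ

end Subdiv

end SSRN

namespace SSRN



/-- translation by a group element as a graph homomorphism -/
def actHom {G V : Type*} [Group G] [MulAction G V] {T : SimpleGraph V} (hact : ActsOn T G)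
    (g : G) : T →g T where
  toFun := fun x => g • x
  map_rel' := fun {a b} h => hact g a b h

theorem btw_smul {G V : Type*} [Group G] [MulAction G V] {T : SimpleGraph V} (hact : ActsOn T G)
    (g : G) {a x b : V} (h : Btw T a x b) (p : T.Walk (g • a) (g • b)) : g • x ∈ p.support := by
  classical
  let q : T.Walk a b := (p.map (actHom hact g⁻¹)).copy
    (inv_smul_smul g a) (inv_smul_smul g b)
  have h1 := q.support_bypass_subset_support (h q.bypass q.bypass_isPath)
  have hs : q.support = p.support.map (fun y => g⁻¹ • y) :=
    (SimpleGraph.Walk.support_copy _ _ _).trans (SimpleGraph.Walk.support_map _ _)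
  rw [hs, List.mem_map] at h1
  obtain ⟨y, hy, hyx⟩ := h1
  have : g⁻¹ • y = x := hyx
  rw [← this, smul_inv_smul]
  exact hy

/-- `x` is in the component of `w` in `T ∖ {v}`. -/
def Rch {V : Type*} (T : SimpleGraph V) (v w x : V) : Prop :=
  ∃ q : T.Walk w x, v ∉ q.support

theorem rch_back {V : Type*} {T : SimpleGraph V} {v w a y : V} (p : T.Walk a v) (hp : p.IsPath)
    (hy : y ∈ p.support) (hR : Rch T v w y) : Rch T v w a := by
  classical
  obtain ⟨q, hq⟩ := hR
  have hyv : y ≠ v := by rintro rfl; exact hq q.end_mem_support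
  refine ⟨q.append (p.takeUntil y hy).reverse, ?_⟩
  have := SimpleGraph.Walk.endpoint_notMem_support_takeUntil hp hy hyv.symm
  simp [SimpleGraph.Walk.mem_support_append_iff, hq, this]

theorem exists_rch {G V : Type*} [Group G] [MulAction G V] {T : SimpleGraph V} (hT : T.IsTree)
    (hact : ActsOn T G) (hmin : MinimalAction T G) {v w : V} (hvw : T.Adj v w) :
    ∃ g : G, Rch T v w (g • v) := by
  classical
  by_contra hno
  push Not at hno
  have hA := hmin {x | ∀ g : G, ¬ Rch T v w (g • x)} ⟨v, hno⟩
    (by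
      intro g a ha h
      rw [← mul_smul]; exact ha _)
    (by
      intro a ha b hb x hx g hR
      obtain ⟨p⟩ := hT.connected.preconnected (g • a) v
      obtain ⟨q⟩ := hT.connected.preconnected (g • b) v
      have h := btw_smul hact g hx (p.bypass.append q.bypass.reverse)
      rw [SimpleGraph.Walk.mem_support_append_iff] at h
      rcases h with h | h
      · exact ha g (rch_back _ p.bypass_isPath h hR)
      · rw [SimpleGraph.Walk.support_reverse, List.mem_reverse] at h
        exact hb g (rch_back _ q.bypass_isPath h hR))
  have hw : w ∈ {x | ∀ g : G, ¬ Rch T v w (g • x)} := by rw [hA]; trivial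
  apply hw 1
  rw [one_smul]
  exact ⟨SimpleGraph.Walk.nil, by simpa using hvw.ne⟩

theorem relIndex_of_cover {G : Type*} [Group G] (H K : Subgroup G) (F : Finset G)
    (h : ∀ k ∈ K, ∃ f ∈ F, k * f⁻¹ ∈ H) : H.relIndex K ≠ 0 := by
  classical
  have hfin : Finite (K ⧸ H.subgroupOf K) := by
    choose! c hcF hc using h
    have : Function.Injective (fun q : K ⧸ H.subgroupOf K =>
        (⟨c (q.out⁻¹ : K), hcF _ (q.out⁻¹).2⟩ : F)) := by
      intro q q' hq
      have hq' : c ((q.out⁻¹ : K) : G) = c ((q'.out⁻¹ : K) : G) := congrArg Subtype.val hq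
      have h1 := hc _ (q.out⁻¹).2
      have h2 := hc _ (q'.out⁻¹).2
      rw [← hq'] at h2
      rw [← q.out_eq, ← q'.out_eq]
      apply QuotientGroup.eq.2
      rw [Subgroup.mem_subgroupOf]
      have := H.mul_mem h1 (H.inv_mem h2)
      simpa [mul_assoc] using this
    exact Finite.of_injective _ this
  exact Subgroup.index_ne_zero_of_finite

theorem cover_of_relIndex {G : Type*} [Group G] (H K : Subgroup G) (h : H.relIndex K ≠ 0) :
    ∃ F : Set G, F.Finite ∧ ∀ k ∈ K, ∃ f ∈ F, f⁻¹ * k ∈ H := by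
  have : (H.subgroupOf K).FiniteIndex := ⟨h⟩
  have hfin : Finite (K ⧸ H.subgroupOf K) := Subgroup.finite_quotient_of_finiteIndex
  refine ⟨Set.range (fun q : K ⧸ H.subgroupOf K => ((q.out : K) : G)), Set.finite_range _, ?_⟩
  intro k hk
  refine ⟨_, ⟨QuotientGroup.mk ⟨k, hk⟩, rfl⟩, ?_⟩
  have : (QuotientGroup.mk (QuotientGroup.mk (s := H.subgroupOf K) ⟨k, hk⟩).out
    : K ⧸ H.subgroupOf K) = QuotientGroup.mk ⟨k, hk⟩ := Quotient.out_eq _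
  have h2 := QuotientGroup.eq.1 this
  rw [Subgroup.mem_subgroupOf] at h2
  simpa using h2

/-- The key covering property. -/
theorem key_cover {G V : Type*} [Group G] [MulAction G V] {T : SimpleGraph V} (hT : T.IsTree)
    (hact : ActsOn T G) (hmin : MinimalAction T G) (H : Subgroup G)
    (v : V) (S : Set V) (hvS : v ∈ S)
    (hcomp : ∀ w ∈ S, w ≠ v → ∀ w' : V,
        (∃ p : T.Walk w w', p.IsPath ∧ v ∉ p.support) → w' ∈ S)
    (hX : IsAI H {g : G | g • v ∉ S}) {w : V} (hvw : T.Adj v w) :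
    ∃ F : Finset G, ∀ k : G, k • v = v → k • w ∉ S → ∃ f ∈ F, k * f⁻¹ ∈ H := by
  classical
  obtain ⟨g, q, hq⟩ := exists_rch (G := G) hT hact hmin hvw
  obtain ⟨F, hF⟩ := hX.2 g
  refine ⟨F.image (· * g⁻¹), ?_⟩
  intro k hkv hkw
  have hmem : k * g ∈ ((· * g) '' {g : G | g • v ∉ S}) ∆ {g : G | g • v ∉ S} := by
    right
    constructor
    · intro hS
      rw [mul_smul] at hS
      let r := (q.map (actHom hact k)).reverse
      have hr : v ∉ r.support := by
        simp only [r, SimpleGraph.Walk.support_reverse, List.mem_reverse,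
          SimpleGraph.Walk.support_map, List.mem_map]
        rintro ⟨y, hy, hyv⟩
        have h1 : k • y = v := hyv
        have h2 : y = v := by
          apply MulAction.injective k
          simp [h1, hkv]
        exact hq (h2 ▸ hy)
      have hne : k • g • v ≠ v := fun h =>
        hr ((congrArg (fun z => z ∈ r.support) h).mp r.start_mem_support)
      exact hkw (hcomp _ hS hne _ ⟨r.bypass, r.bypass_isPath,
        fun h => hr (r.support_bypass_subset_support h)⟩)
    · rintro ⟨x, hx, hxk⟩
      have : x = k := mul_right_cancel hxk
      subst this
      exact hx (by rw [hkv]; exact hvS)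
  have := hF hmem
  simp only [Set.mem_iUnion] at this
  obtain ⟨f, hf, h, hh, hhf⟩ := this
  refine ⟨f * g⁻¹, Finset.mem_image_of_mem _ hf, ?_⟩
  have : k * (f * g⁻¹)⁻¹ = h := by
    have h3 : h * f = k * g := hhf
    rw [mul_inv_rev, inv_inv, ← mul_assoc, ← h3]; simp
  rw [this]; exact hh

/-- If `X = {g | g·v ∉ S}` is an `H`-almost invariant set, where `S` is a
subtree containing `v` with `S ∖ {v}` a union of components of `T ∖ {v}`, then the
coboundary `δS` (the edges `vw` with `w ∉ S`) is a finite set of edges whose stabilizers are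
commensurable with `H`. -/
theorem stmt_18 {G V : Type*} [Group G] [MulAction G V]
    (hGfg : Group.FG G)
    (T : SimpleGraph V) (hT : T.IsTree) (hact : ActsOn T G) (hinv : NoInversions T G)
    (E : Set (Subgroup G)) (hE : Admissible E) (hET : IsETree T G E)
    (hmin : MinimalAction T G) (hnt : NontrivialAction (V := V) G)
    (hfo : FinEdgeOrbits T G)
    (H : Subgroup G) (hH : H ∈ E)
    (v : V) (S : Set V) (hvS : v ∈ S)
    (hconv : ∀ u ∈ S, ∀ w ∈ S, ∀ x : V, Btw T u x w → x ∈ S)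
    (hcomp : ∀ w ∈ S, w ≠ v → ∀ w' : V,
        (∃ p : T.Walk w w', p.IsPath ∧ v ∉ p.support) → w' ∈ S)
    (hX : IsAI H {g : G | g • v ∉ S}) :
    {e : Sym2 V | e ∈ T.edgeSet ∧ ∃ w : V, e = s(v, w) ∧ w ∉ S}.Finite ∧
      ∀ e ∈ {e : Sym2 V | e ∈ T.edgeSet ∧ ∃ w : V, e = s(v, w) ∧ w ∉ S},
        Subgroup.Commensurable (edgeStab G e) H := by
  classical
  have hcov : ∀ {w : V}, T.Adj v w → ∃ F : Finset G, ∀ k : G, k • v = v → k • w ∉ S →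
      ∃ f ∈ F, k * f⁻¹ ∈ H := fun {w} hvw => key_cover hT hact hmin H v S hvS hcomp hX hvw
  have hstab : ∀ {w : V}, T.Adj v w → ∀ k ∈ edgeStab G s(v, w), k • v = v ∧ k • w = w := by
    intro w hvw k hk
    have h1 : s(k • v, k • w) = s(v, w) := hk
    rw [Sym2.eq_iff] at h1
    rcases h1 with h1 | h1
    · exact h1
    · exact absurd h1 (hinv k v w hvw)
  have hcomm : ∀ {w : V}, T.Adj v w → w ∉ S →
      Subgroup.Commensurable (edgeStab G s(v, w)) H := by
    intro w hvw hw
    obtain ⟨F, hF⟩ := hcov hvw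
    have h1 : H.relIndex (edgeStab G s(v, w)) ≠ 0 := by
      apply relIndex_of_cover _ _ F
      intro k hk
      obtain ⟨ha, hb⟩ := hstab hvw k hk
      exact hF k ha (by rwa [hb])
    have hGe : edgeStab G s(v, w) ∈ E := hET _ hvw
    have h2 : H ⊓ edgeStab G s(v, w) ∈ E := by
      apply hE.2.1 _ hGe
      constructor
      · rwa [Subgroup.inf_relIndex_right]
      · rw [Subgroup.relIndex_eq_one.2 inf_le_right]; exact one_ne_zero
    have h3 := hE.2.2 _ h2 _ hH inf_le_left
    rw [Subgroup.inf_relIndex_left] at h3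
    exact ⟨h3, h1⟩
  have horb : ∀ {w : V}, T.Adj v w →
      {w' | ∃ k : G, k • v = v ∧ k • w = w' ∧ w' ∉ S}.Finite := by
    intro w hvw
    obtain ⟨F, hF⟩ := hcov hvw
    have hsub : {w' | ∃ k : G, k • v = v ∧ k • w = w' ∧ w' ∉ S} ⊆
        ⋃ f ∈ (F : Set G), {w' | ∃ k : G, k • v = v ∧ k • w = w' ∧ w' ∉ S ∧ k * f⁻¹ ∈ H} := by
      rintro w' ⟨k, hk, hkw, hw'⟩
      obtain ⟨f, hf, hfH⟩ := hF k hk (by rwa [hkw])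
      simp only [Set.mem_iUnion]
      exact ⟨f, hf, k, hk, hkw, hw', hfH⟩
    refine Set.Finite.subset (Set.Finite.biUnion F.finite_toSet ?_) hsub
    intro f _
    by_cases hne : ∃ k₀ : G, k₀ • v = v ∧ k₀ • w ∉ S ∧ k₀ * f⁻¹ ∈ H
    · obtain ⟨k₀, hk₀, hk₀w, hk₀H⟩ := hne
      have hadj : T.Adj v (k₀ • w) := by
        have := hact k₀ _ _ hvw
        rwa [hk₀] at this
      obtain ⟨C, hCfin, hC⟩ := cover_of_relIndex _ _ (hcomm hadj hk₀w).1
      apply (hCfin.image (fun c => c • (k₀ • w))).subset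
      rintro w' ⟨k, hk, hkw, hw', hkH⟩
      have hh : k * k₀⁻¹ ∈ H := by
        have := H.mul_mem hkH (H.inv_mem hk₀H)
        simpa [mul_assoc] using this
      obtain ⟨c, hc, hcs⟩ := hC _ hh
      refine ⟨c, hc, ?_⟩
      have h4 := (hstab hadj _ hcs).2
      have h5 : c • ((c⁻¹ * (k * k₀⁻¹)) • (k₀ • w)) = w' := by
        rw [← hkw]; simp [mul_smul]
      rw [h4] at h5
      exact h5
    · convert Set.finite_empty
      ext w'
      simp only [Set.mem_ofPred_eq, Set.mem_empty_iff_false, iff_false]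
      rintro ⟨k, hk, hkw, hw', hkH⟩
      exact hne ⟨k, hk, by rwa [hkw], hkH⟩
  have horb2 : ∀ a b : V,
      {w | T.Adj v w ∧ w ∉ S ∧ ∃ g : G, g • a = v ∧ g • b = w}.Finite := by
    intro a b
    by_cases hne : ∃ (g₀ : G), g₀ • a = v ∧ T.Adj v (g₀ • b)
    · obtain ⟨g₀, hg₀, hadj⟩ := hne
      apply (horb hadj).subset
      rintro w ⟨hvw, hw, g, hga, hgb⟩
      refine ⟨g * g₀⁻¹, ?_, ?_, hw⟩
      · rw [← hg₀, mul_smul, inv_smul_smul, hga, hg₀]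
      · rw [mul_smul, inv_smul_smul, hgb]
    · convert Set.finite_empty
      ext w
      simp only [Set.mem_ofPred_eq, Set.mem_empty_iff_false, iff_false]
      rintro ⟨hvw, hw, g, hga, hgb⟩
      exact hne ⟨g, hga, by rwa [hgb]⟩
  constructor
  · obtain ⟨F, hF⟩ := hfo
    have hfin : (⋃ e₀ ∈ (F : Set (Sym2 V)), (fun w => s(v, w)) ''
        ({w | T.Adj v w ∧ w ∉ S ∧ ∃ g : G, g • e₀.out.1 = v ∧ g • e₀.out.2 = w} ∪
         {w | T.Adj v w ∧ w ∉ S ∧ ∃ g : G, g • e₀.out.2 = v ∧ g • e₀.out.1 = w})).Finite :=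
      Set.Finite.biUnion F.finite_toSet
        (fun e₀ _ => ((horb2 _ _).union (horb2 _ _)).image _)
    apply hfin.subset
    rintro e ⟨he, w, rfl, hw⟩
    have hvw : T.Adj v w := he
    obtain ⟨e₀, he₀, g, hg⟩ := hF _ he
    simp only [Set.mem_iUnion]
    refine ⟨e₀, he₀, w, ?_, rfl⟩
    have h0 : s(e₀.out.1, e₀.out.2) = e₀ := Quot.out_eq e₀
    rw [← h0, Sym2.map_mk, Sym2.eq_iff] at hg
    rcases hg with ⟨h1, h2⟩ | ⟨h1, h2⟩
    · exact Or.inl ⟨hvw, hw, g, h1, h2⟩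
    · exact Or.inr ⟨hvw, hw, g, h2, h1⟩
  · rintro e ⟨he, w, rfl, hw⟩
    exact hcomm he hw

end SSRN
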